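/- arXiv:2507.08725 — 4 statements merged into one kernel-verified Lean document; each statement's English description precedes it below -/
import Mathlib

section
/- Let σ be a feasible single-processor schedule and let v_r, …, v_s be a block of σ whose start time is b_k + α with 0 < α (its start lies strictly inside interval I_k) and whose end time is b_ℓ + β with 0 < β (its end lies in interval I_ℓ), where k ≤ ℓ and 𝒢_k ≥ 𝒢_ℓ. Let γ = 0 if no task of σ completes in the interval (b_k, b_k + α], and otherwise let b_k + γ be the completion time of the last task scheduled before v_r (so that γ < α). Then the schedule σ' obtained from σ by decreasing the start times of v_r, …, v_s by δ = min(α − γ, β), leaving all other start times unchanged, is feasible and satisfies CC(σ') ≤ CC(σ). -/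
/-!
Single-processor carbon-aware scheduling: shifting a non-aligned block left by
`δ = min(α - γ, β)` towards an interval with a larger green budget preserves
feasibility and does not increase the carbon cost.
-/

/-- A feasible schedule: tasks are executed in order without overlap,
and the last task completes by the deadline `T`. -/
def Feasible (n T : ℕ) (ω : ℕ → ℕ) (σ : ℕ → ℕ) : Prop :=
  (∀ i, i + 1 < n → σ i + ω i ≤ σ (i + 1)) ∧ (0 < n → σ (n - 1) + ω (n - 1) ≤ T)

/-- The processor is active at time unit `t`. -/
def Active (n : ℕ) (ω : ℕ → ℕ) (σ : ℕ → ℕ) (t : ℕ) : Prop :=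
  ∃ i < n, σ i ≤ t ∧ t < σ i + ω i

/-- Power consumed at time unit `t`. -/
noncomputable def Power (n : ℕ) (ω : ℕ → ℕ) (Pidle Pwork : ℕ) (σ : ℕ → ℕ) (t : ℕ) : ℕ :=
  @ite ℕ (Active n ω σ t) (Classical.propDecidable _) (Pidle + Pwork) Pidle

/-- Carbon cost of a schedule: `∑_{t<T} max(P(t) - G(t), 0)`. -/
noncomputable def CC (n T : ℕ) (ω : ℕ → ℕ) (Pidle Pwork : ℕ) (G : ℕ → ℕ) (σ : ℕ → ℕ) : ℕ :=
  ∑ t ∈ Finset.range T, (Power n ω Pidle Pwork σ t - G t)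

/-- `v_r, …, v_s` form a block of σ: a maximal run of back-to-back tasks. -/
def IsBlock (n : ℕ) (ω : ℕ → ℕ) (σ : ℕ → ℕ) (r s : ℕ) : Prop :=
  r ≤ s ∧ s < n ∧
  (∀ i, r ≤ i → i < s → σ (i + 1) = σ i + ω i) ∧
  (r = 0 ∨ σ (r - 1) + ω (r - 1) < σ r) ∧
  (s = n - 1 ∨ σ s + ω s < σ (s + 1))

theorem Feasible.completion_le {n T : ℕ} {ω σ : ℕ → ℕ} (h : Feasible n T ω σ) {i j : ℕ}
    (hij : i < j) (hj : j < n) : σ i + ω i ≤ σ j := by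
  induction j, hij using Nat.le_induction with
  | base => exact h.1 i hj
  | succ j _ ih =>
    have h₁ := ih (by omega)
    have h₂ := h.1 j hj
    omega

theorem Feasible.completion_le_deadline {n T : ℕ} {ω σ : ℕ → ℕ} (h : Feasible n T ω σ) {i : ℕ}
    (hi : i < n) : σ i + ω i ≤ T := by
  have hT := h.2 (by omega)
  rcases Nat.lt_or_ge i (n - 1) with hlt | hge
  · have := h.completion_le hlt (by omega)
    omega
  · obtain rfl : i = n - 1 := by omega
    exact hT

/-- The starts of back-to-back tasks are nondecreasing. -/
theorem start_le_of_consecutive {ω σ : ℕ → ℕ} {r s : ℕ}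
    (hc : ∀ i, r ≤ i → i < s → σ (i + 1) = σ i + ω i) {i : ℕ} (hri : r ≤ i) (his : i ≤ s) :
    σ r ≤ σ i := by
  induction i, hri using Nat.le_induction with
  | base => exact le_rfl
  | succ i hri ih =>
    have h₁ := ih (by omega)
    have h₂ := hc i hri (by omega)
    omega

/-- Back-to-back tasks cover exactly the time from the first start to the last completion. -/
theorem exists_running_iff_of_consecutive {ω σ : ℕ → ℕ} {r s : ℕ} (hrs : r ≤ s)
    (hc : ∀ i, r ≤ i → i < s → σ (i + 1) = σ i + ω i) (t : ℕ) :
    (∃ i, (r ≤ i ∧ i ≤ s) ∧ σ i ≤ t ∧ t < σ i + ω i) ↔ σ r ≤ t ∧ t < σ s + ω s := by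
  induction s, hrs using Nat.le_induction with
  | base =>
    constructor
    · rintro ⟨i, hi, ht⟩
      obtain rfl : i = r := by omega
      exact ht
    · exact fun ht => ⟨r, ⟨le_rfl, le_rfl⟩, ht⟩
  | succ s hrs ih =>
    have ih := ih fun i h₁ h₂ => hc i h₁ (by omega)
    have hs := hc s hrs (by omega)
    have hr := start_le_of_consecutive hc hrs (by omega)
    constructor
    · rintro ⟨i, hi, ht⟩
      rcases Nat.lt_or_ge s i with hlt | hge
      · obtain rfl : i = s + 1 := by omega
        omega
      · have := ih.1 ⟨i, ⟨hi.1, hge⟩, ht⟩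
        omega
    · intro ht
      rcases Nat.lt_or_ge t (σ s + ω s) with hlt | hge
      · obtain ⟨i, hi, hti⟩ := ih.2 ⟨ht.1, hlt⟩
        exact ⟨i, ⟨hi.1, by omega⟩, hti⟩
      · exact ⟨s + 1, ⟨by omega, le_rfl⟩, by omega, ht.2⟩

/-- The carbon cost of a feasible schedule splits into the idle cost, the extra cost of the tasks
outside a back-to-back run, and the extra cost of that run. -/
theorem Feasible.CC_eq_of_consecutive {n T : ℕ} {ω σ : ℕ → ℕ} (h : Feasible n T ω σ)
    (Pidle Pwork : ℕ) (G : ℕ → ℕ) {r s : ℕ} (hrs : r ≤ s) (hsn : s < n)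
    (hc : ∀ i, r ≤ i → i < s → σ (i + 1) = σ i + ω i) (A : ℕ → Prop) [DecidablePred A]
    (hA : ∀ t, A t ↔ ∃ i < n, ¬(r ≤ i ∧ i ≤ s) ∧ σ i ≤ t ∧ t < σ i + ω i) :
    CC n T ω Pidle Pwork G σ =
      ∑ t ∈ Finset.range T, (Pidle - G t) +
      ∑ t ∈ Finset.range T with A t, (Pidle + Pwork - G t - (Pidle - G t)) +
      ∑ t ∈ Finset.Ico (σ r) (σ s + ω s), (Pidle + Pwork - G t - (Pidle - G t)) := by
  have hT := h.completion_le_deadline hsn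
  have hrun := exists_running_iff_of_consecutive hrs hc
  have hIco : Finset.Ico (σ r) (σ s + ω s) =
      {t ∈ Finset.range T | σ r ≤ t ∧ t < σ s + ω s} := by
    ext t
    simp only [Finset.mem_Ico, Finset.mem_filter, Finset.mem_range]
    omega
  have hactive : ∀ t, Active n ω σ t ↔ A t ∨ (σ r ≤ t ∧ t < σ s + ω s) := by
    intro t
    rw [hA, ← hrun]
    constructor
    · rintro ⟨i, hi, ht⟩
      by_cases his : r ≤ i ∧ i ≤ s
      · exact Or.inr ⟨i, his, ht⟩
      · exact Or.inl ⟨i, hi, his, ht⟩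
    · rintro (⟨i, hi, -, ht⟩ | ⟨i, hi, ht⟩)
      · exact ⟨i, hi, ht⟩
      · exact ⟨i, by omega, ht⟩
  have hdisj : ∀ t, A t → ¬(σ r ≤ t ∧ t < σ s + ω s) := by
    intro t ht hblock
    obtain ⟨i, hi, his, hti⟩ := (hA t).1 ht
    rcases Nat.lt_or_ge i r with hlt | hge
    · have := h.completion_le hlt (by omega)
      omega
    · have := h.completion_le (show s < i by omega) hi
      omega
  rw [hIco, Finset.sum_filter, Finset.sum_filter, ← Finset.sum_add_distrib,
    ← Finset.sum_add_distrib, CC]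
  refine Finset.sum_congr rfl fun t _ => ?_
  have ha := hactive t
  have hd := hdisj t
  unfold Power
  by_cases h₁ : A t <;> by_cases h₂ : σ r ≤ t ∧ t < σ s + ω s
  · exact absurd h₂ (hd h₁)
  all_goals
    simp only [ha, h₁, h₂, and_self, or_true, true_or, or_self, if_true, if_false]
    omega

/-- Sliding a window left does not increase a sum if the values gained are bounded by those lost. -/
theorem sum_Ico_sub_le {D : ℕ → ℕ} {a e δ x y : ℕ} (hae : a ≤ e) (hδ : δ ≤ a)
    (hx : ∀ t, a - δ ≤ t → t < a → D t = x) (hy : ∀ t, e - δ ≤ t → t < e → D t = y)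
    (hxy : x ≤ y) :
    ∑ t ∈ Finset.Ico (a - δ) (e - δ), D t ≤ ∑ t ∈ Finset.Ico a e, D t := by
  have h₁ := Finset.sum_Ico_consecutive D (show a - δ ≤ e - δ by omega) (Nat.sub_le e δ)
  have h₂ := Finset.sum_Ico_consecutive D (Nat.sub_le a δ) hae
  have hgain : ∑ t ∈ Finset.Ico (a - δ) a, D t = δ * x := by
    rw [Finset.sum_congr rfl fun t ht => hx t (Finset.mem_Ico.1 ht).1 (Finset.mem_Ico.1 ht).2]
    simp [Nat.sub_sub_self hδ]
  have hloss : ∑ t ∈ Finset.Ico (e - δ) e, D t = δ * y := by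
    rw [Finset.sum_congr rfl fun t ht => hy t (Finset.mem_Ico.1 ht).1 (Finset.mem_Ico.1 ht).2]
    simp [Nat.sub_sub_self (hδ.trans hae)]
  have := Nat.mul_le_mul_left δ hxy
  omega

/-- Shifting a block `v_r, …, v_s` that starts strictly inside interval `I_k`
(at time `bnd k + α`, `0 < α`) and ends inside interval `I_ℓ` (at time `bnd ℓ + β`,
`0 < β`), with `k ≤ ℓ` and `𝒢 ℓ ≤ 𝒢 k`, left by `δ = min (α - γ) β` yields a feasible
schedule whose carbon cost is no larger. -/
theorem block_shift_left
    (n T J : ℕ) (ω : ℕ → ℕ) (bnd : ℕ → ℕ) (𝒢 : ℕ → ℕ) (G : ℕ → ℕ) (Pidle Pwork : ℕ)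
    (hω : ∀ i, i < n → 0 < ω i)
    (hbnd0 : bnd 0 = 0) (hbndJ : bnd J = T)
    (hmono : ∀ j, j < J → bnd j < bnd (j + 1))
    (hG : ∀ j, j < J → ∀ t, bnd j ≤ t → t < bnd (j + 1) → G t = 𝒢 j)
    (σ : ℕ → ℕ) (hσ : Feasible n T ω σ)
    (r s k ℓ α β γ : ℕ)
    (hblock : IsBlock n ω σ r s)
    (hkℓ : k ≤ ℓ) (hℓJ : ℓ < J)
    (hα : 0 < α) (hstart : σ r = bnd k + α) (hstartin : bnd k + α < bnd (k + 1))
    (hβ : 0 < β) (hend : σ s + ω s = bnd ℓ + β) (hendin : bnd ℓ + β ≤ bnd (ℓ + 1))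
    (hbudget : 𝒢 ℓ ≤ 𝒢 k)
    (hγ : (γ = 0 ∧ ∀ i, i < n → ¬ (bnd k < σ i + ω i ∧ σ i + ω i ≤ bnd k + α)) ∨
          (0 < r ∧ σ (r - 1) + ω (r - 1) = bnd k + γ ∧ γ < α)) :
    Feasible n T ω
        (fun i => if r ≤ i ∧ i ≤ s then σ i - min (α - γ) β else σ i) ∧
      CC n T ω Pidle Pwork G
          (fun i => if r ≤ i ∧ i ≤ s then σ i - min (α - γ) β else σ i)
        ≤ CC n T ω Pidle Pwork G σ := by
  obtain ⟨hrs, hsn, hc, -, -⟩ := hblock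
  set δ := min (α - γ) β with hδ
  have hδα : δ ≤ α - γ := min_le_left _ _
  have hδβ : δ ≤ β := min_le_right _ _
  clear_value δ
  have hprev : ∀ i, i + 1 = r → σ i + ω i ≤ bnd k + γ := by
    rintro i rfl
    rcases hγ with ⟨rfl, hnone⟩ | ⟨-, heq, -⟩
    · have h₁ := hnone i (by omega)
      have h₂ := hσ.completion_le (Nat.lt_succ_self i) (by omega)
      simp only [Nat.succ_eq_add_one] at h₂
      omega
    · exact heq.le
  have hγα : γ < α := by
    rcases hγ with ⟨rfl, -⟩ | ⟨-, -, hlt⟩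
    exacts [hα, hlt]
  have hstarts : ∀ i, r ≤ i → i ≤ s → σ r ≤ σ i := fun i => start_le_of_consecutive hc
  have hfeas : Feasible n T ω (fun i => if r ≤ i ∧ i ≤ s then σ i - δ else σ i) := by
    constructor
    · intro i hi
      have hstep := hσ.1 i hi
      have hp := hprev i
      have hs₁ := hstarts i
      have hs₂ := hstarts (i + 1)
      by_cases hir : i + 1 = r
      · subst hir
        simp only [le_refl, hrs, and_self, if_true, show ¬(i + 1 ≤ i ∧ i ≤ s) by omega, if_false]
        omega
      · dsimp only
        split_ifs <;> omega
    · intro hn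
      have := hσ.2 hn
      dsimp only
      split_ifs <;> omega
  refine ⟨hfeas, ?_⟩
  have hc' : ∀ i, r ≤ i → i < s →
      (fun i => if r ≤ i ∧ i ≤ s then σ i - δ else σ i) (i + 1) =
        (fun i => if r ≤ i ∧ i ≤ s then σ i - δ else σ i) i + ω i := by
    intro i hri his
    have := hc i hri his
    have := hstarts i hri his.le
    dsimp only
    rw [if_pos (by omega), if_pos (by omega)]
    omega
  classical
  rw [hσ.CC_eq_of_consecutive Pidle Pwork G hrs hsn hc
      (fun t => ∃ i < n, ¬(r ≤ i ∧ i ≤ s) ∧ σ i ≤ t ∧ t < σ i + ω i) (fun _ => Iff.rfl),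
    hfeas.CC_eq_of_consecutive Pidle Pwork G hrs hsn hc'
      (fun t => ∃ i < n, ¬(r ≤ i ∧ i ≤ s) ∧ σ i ≤ t ∧ t < σ i + ω i)
      (fun t => exists_congr fun i => and_congr_right fun _ => and_congr_right fun hi => by
        simp only [if_neg hi])]
  refine Nat.add_le_add_left ?_ _
  have hrs_start := hstarts s hrs le_rfl
  simp only [le_refl, hrs, and_self, if_true]
  rw [show σ s - δ + ω s = σ s + ω s - δ by omega]
  refine sum_Ico_sub_le (x := Pidle + Pwork - 𝒢 k - (Pidle - 𝒢 k))
    (y := Pidle + Pwork - 𝒢 ℓ - (Pidle - 𝒢 ℓ)) (by omega) (by omega) ?_ ?_ (by omega)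
  · intro t h₁ h₂
    rw [hG k (by omega) t (by omega) (by omega)]
  · intro t h₁ h₂
    rw [hG ℓ hℓJ t (by omega) (by omega)]
end

section
/- Every feasible single-processor schedule σ satisfies the decomposition CC(σ) = Σ_{t=0}^{T−1} max(P_idle − G(t), 0) + Σ_{i=1}^{n} cc(v_i, σ(v_i) + ω(v_i)). -/
/-- Incremental cost of executing task `i` so that it ends at time `t`:
`cc(v_i, t) = Σ_{s=t-ω(v_i)}^{t-1} (max(Pidle+Pwork-G(s),0) - max(Pidle-G(s),0))`
(all subtractions are truncated subtraction on `ℕ`, which matches the real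
difference since the summands are nonnegative and pointwise ordered). -/
def cc (ω : ℕ → ℕ) (Pidle Pwork : ℕ) (G : ℕ → ℕ) (i t : ℕ) : ℕ :=
  ∑ s ∈ Finset.Ico (t - ω i) t, ((Pidle + Pwork - G s) - (Pidle - G s))

theorem Feasible.end_le_start {n T : ℕ} {ω σ : ℕ → ℕ} (hσ : Feasible n T ω σ)
    {i j : ℕ} (hij : i < j) (hj : j < n) : σ i + ω i ≤ σ j := by
  induction j, hij using Nat.le_induction with
  | base => exact hσ.1 i hj
  | succ k hk ih =>
    have h₁ := ih (by omega)
    have h₂ := hσ.1 k hj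
    omega

theorem Feasible.end_le_deadline {n T : ℕ} {ω σ : ℕ → ℕ} (hσ : Feasible n T ω σ)
    {i : ℕ} (hi : i < n) : σ i + ω i ≤ T := by
  have hlast := hσ.2 (by omega)
  rcases eq_or_ne i (n - 1) with rfl | hne
  · exact hlast
  · have h := hσ.end_le_start (show i < n - 1 by omega) (by omega)
    omega

/-- At most one task runs at any time. -/
theorem Feasible.eq_of_running {n T : ℕ} {ω σ : ℕ → ℕ} (hσ : Feasible n T ω σ)
    {i j t : ℕ} (hi : i < n) (hj : j < n) (hit : σ i ≤ t ∧ t < σ i + ω i)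
    (hjt : σ j ≤ t ∧ t < σ j + ω j) : i = j := by
  rcases lt_trichotomy i j with hij | hij | hij
  · have h := hσ.end_le_start hij hj
    omega
  · exact hij
  · have h := hσ.end_le_start hij hi
    omega

/-- The incremental cost of a task is a sum over the whole horizon, supported on the time units
at which the task runs. -/
theorem cc_eq_sum_range {ω : ℕ → ℕ} {T s i : ℕ} (Pidle Pwork : ℕ) (G : ℕ → ℕ)
    (h : s + ω i ≤ T) :
    cc ω Pidle Pwork G i (s + ω i) = ∑ t ∈ Finset.range T,
      if s ≤ t ∧ t < s + ω i then (Pidle + Pwork - G t) - (Pidle - G t) else 0 := by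
  rw [cc, Nat.add_sub_cancel, ← Finset.sum_filter]
  congr 1
  ext t
  simp only [Finset.mem_Ico, Finset.mem_filter, Finset.mem_range]
  omega

theorem Feasible.power_sub_eq {n T : ℕ} {ω σ : ℕ → ℕ} (hσ : Feasible n T ω σ)
    (Pidle Pwork : ℕ) (G : ℕ → ℕ) (t : ℕ) :
    Power n ω Pidle Pwork σ t - G t = (Pidle - G t) + ∑ i ∈ Finset.range n,
      if σ i ≤ t ∧ t < σ i + ω i then (Pidle + Pwork - G t) - (Pidle - G t) else 0 := by
  by_cases hA : Active n ω σ t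
  · obtain ⟨i, hi, hit⟩ := id hA
    rw [Power, if_pos hA, Finset.sum_eq_single_of_mem i (Finset.mem_range.2 hi), if_pos hit]
    · omega
    · intro j hj hji
      exact if_neg fun hjt => hji (hσ.eq_of_running (Finset.mem_range.1 hj) hi hjt hit)
  · rw [Power, if_neg hA, Finset.sum_eq_zero, add_zero]
    intro i hi
    exact if_neg fun hit => hA ⟨i, Finset.mem_range.1 hi, hit⟩

/-- Cost decomposition for feasible single-processor schedules. -/
theorem CC_decomposition
    (n T J : ℕ) (ω : ℕ → ℕ) (bnd : ℕ → ℕ) (𝒢 : ℕ → ℕ) (G : ℕ → ℕ) (Pidle Pwork : ℕ)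
    (hω : ∀ i, i < n → 0 < ω i)
    (hbnd0 : bnd 0 = 0) (hbndJ : bnd J = T)
    (hmono : ∀ j, j < J → bnd j < bnd (j + 1))
    (hG : ∀ j, j < J → ∀ t, bnd j ≤ t → t < bnd (j + 1) → G t = 𝒢 j)
    (σ : ℕ → ℕ) (hσ : Feasible n T ω σ) :
    CC n T ω Pidle Pwork G σ =
      (∑ t ∈ Finset.range T, (Pidle - G t)) +
        ∑ i ∈ Finset.range n, cc ω Pidle Pwork G i (σ i + ω i) := by
  have hcc : ∀ i ∈ Finset.range n, cc ω Pidle Pwork G i (σ i + ω i) = _ := fun i hi =>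
    cc_eq_sum_range Pidle Pwork G (hσ.end_le_deadline (Finset.mem_range.1 hi))
  rw [Finset.sum_congr rfl hcc, Finset.sum_comm, ← Finset.sum_add_distrib]
  exact Finset.sum_congr rfl fun t _ => hσ.power_sub_eq Pidle Pwork G t
end

section
/- If Σ_{i=1}^{n} ω(v_i) ≤ T, then the minimum carbon cost over all feasible schedules equals min{ Opt(n, t) : Σ_{i=1}^{n} ω(v_i) ≤ t ≤ T } + Σ_{t=0}^{T−1} max(P_idle − G(t), 0). -/
/-- `Opt i t`: minimal total incremental cost of a partial schedule of the first
`i` tasks in which task `i - 1` completes exactly at time `t`. -/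
noncomputable def Opt (ω : ℕ → ℕ) (Pidle Pwork : ℕ) (G : ℕ → ℕ) (i t : ℕ) : ℕ :=
  sInf {c | ∃ τ : ℕ → ℕ,
    (∀ j, j + 1 < i → τ j + ω j ≤ τ (j + 1)) ∧
    τ (i - 1) + ω (i - 1) = t ∧
    c = ∑ j ∈ Finset.range i, cc ω Pidle Pwork G j (τ j + ω j)}

theorem completion_le_start {n : ℕ} {ω σ : ℕ → ℕ}
    (h : ∀ i, i + 1 < n → σ i + ω i ≤ σ (i + 1)) {i j : ℕ} (hij : i < j) (hj : j < n) :
    σ i + ω i ≤ σ j := by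
  induction j, hij using Nat.le_induction with
  | base => exact h i hj
  | succ j hij ih => exact (ih (by omega)).trans ((Nat.le_add_right _ _).trans (h j hj))

theorem sum_durations_le_completion {n : ℕ} {ω σ : ℕ → ℕ}
    (h : ∀ i, i + 1 < n → σ i + ω i ≤ σ (i + 1)) {k : ℕ} (hk : k < n) :
    ∑ i ∈ Finset.range (k + 1), ω i ≤ σ k + ω k := by
  induction k with
  | zero => simp
  | succ k ih =>
    rw [Finset.sum_range_succ]
    have h₁ := ih (by omega)
    have h₂ := h k hk
    omega

/-- The carbon cost of a feasible schedule splits into incremental costs and the idle baseline. -/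
theorem Feasible.CC_eq {n T : ℕ} {ω σ : ℕ → ℕ} (hσ : Feasible n T ω σ)
    (Pidle Pwork : ℕ) (G : ℕ → ℕ) :
    CC n T ω Pidle Pwork G σ =
      ∑ j ∈ Finset.range n, cc ω Pidle Pwork G j (σ j + ω j) +
        ∑ t ∈ Finset.range T, (Pidle - G t) := by
  classical
  obtain ⟨hord, hend⟩ := hσ
  have hle : ∀ j < n, σ j + ω j ≤ T := by
    intro j hj
    have hn := hend (by omega)
    rcases Nat.lt_or_ge j (n - 1) with hlt | hge
    · have := completion_le_start hord hlt (by omega)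
      omega
    · obtain rfl : j = n - 1 := by omega
      exact hn
  have hactive : (Finset.range T).filter (Active n ω σ) =
      (Finset.range n).biUnion fun j ↦ Finset.Ico (σ j) (σ j + ω j) := by
    ext t
    simp only [Finset.mem_filter, Finset.mem_range, Finset.mem_biUnion, Finset.mem_Ico, Active]
    refine ⟨fun h ↦ h.2, fun h ↦ ⟨?_, h⟩⟩
    obtain ⟨j, hj, -, ht⟩ := h
    exact ht.trans_le (hle j hj)
  have hdisj : (↑(Finset.range n) : Set ℕ).PairwiseDisjoint
      fun j ↦ Finset.Ico (σ j) (σ j + ω j) := by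
    intro i hi j hj hij
    rw [Finset.mem_coe, Finset.mem_range] at hi hj
    refine Finset.disjoint_left.2 fun t hti htj ↦ ?_
    rw [Finset.mem_Ico] at hti htj
    rcases Nat.lt_or_gt_of_ne hij with h | h
    · have := completion_le_start hord h hj
      omega
    · have := completion_le_start hord h hi
      omega
  have hpower : ∀ t, Power n ω Pidle Pwork σ t - G t =
      (if Active n ω σ t then (Pidle + Pwork - G t) - (Pidle - G t) else 0) +
        (Pidle - G t) := by
    intro t
    unfold Power
    split_ifs <;> omega
  simp only [CC, cc, hpower, Nat.add_sub_cancel]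
  rw [Finset.sum_add_distrib, ← Finset.sum_filter, hactive, Finset.sum_biUnion hdisj]

/-- The tasks can be executed back to back so that the last one completes at any given
sufficiently late time. -/
theorem Opt_attained {ω : ℕ → ℕ} (Pidle Pwork : ℕ) (G : ℕ → ℕ) {n t : ℕ} (hn : 0 < n)
    (ht : ∑ i ∈ Finset.range n, ω i ≤ t) :
    ∃ τ : ℕ → ℕ, (∀ j, j + 1 < n → τ j + ω j ≤ τ (j + 1)) ∧ τ (n - 1) + ω (n - 1) = t ∧
      Opt ω Pidle Pwork G n t = ∑ j ∈ Finset.range n, cc ω Pidle Pwork G j (τ j + ω j) := by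
  refine Nat.sInf_mem (s := {c | ∃ τ : ℕ → ℕ, (∀ j, j + 1 < n → τ j + ω j ≤ τ (j + 1)) ∧
    τ (n - 1) + ω (n - 1) = t ∧
    c = ∑ j ∈ Finset.range n, cc ω Pidle Pwork G j (τ j + ω j)}) ?_
  refine ⟨_, fun j ↦ t - ∑ i ∈ Finset.range n, ω i + ∑ i ∈ Finset.range j, ω i, ?_, ?_, rfl⟩
  · intro j _
    simp only [Finset.sum_range_succ]
    omega
  · obtain ⟨m, rfl⟩ : ∃ m, n = m + 1 := ⟨n - 1, by omega⟩
    simp only [Nat.add_sub_cancel]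
    rw [Finset.sum_range_succ] at ht ⊢
    omega

/-- Correctness of the dynamic program: if `Σ ω ≤ T`, the minimum carbon cost of
a feasible schedule is `min_t Opt(n, t)` plus the idle baseline cost. -/
theorem min_CC_eq_Opt
    (n T J : ℕ) (ω : ℕ → ℕ) (bnd : ℕ → ℕ) (𝒢 : ℕ → ℕ) (G : ℕ → ℕ) (Pidle Pwork : ℕ)
    (hn : 0 < n)
    (hω : ∀ i, i < n → 0 < ω i)
    (hbnd0 : bnd 0 = 0) (hbndJ : bnd J = T)
    (hmono : ∀ j, j < J → bnd j < bnd (j + 1))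
    (hG : ∀ j, j < J → ∀ t, bnd j ≤ t → t < bnd (j + 1) → G t = 𝒢 j)
    (hfit : ∑ i ∈ Finset.range n, ω i ≤ T) :
    sInf {c | ∃ σ : ℕ → ℕ, Feasible n T ω σ ∧ c = CC n T ω Pidle Pwork G σ} =
      sInf {c | ∃ t, (∑ i ∈ Finset.range n, ω i) ≤ t ∧ t ≤ T ∧
          c = Opt ω Pidle Pwork G n t} +
        ∑ t ∈ Finset.range T, (Pidle - G t) := by
  apply le_antisymm
  · obtain ⟨t, hst, htT, ht⟩ := Nat.sInf_mem (s := {c | ∃ t,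
      (∑ i ∈ Finset.range n, ω i) ≤ t ∧ t ≤ T ∧ c = Opt ω Pidle Pwork G n t})
      ⟨_, T, hfit, le_rfl, rfl⟩
    obtain ⟨τ, hord, hlast, hopt⟩ := Opt_attained Pidle Pwork G hn hst
    have hτ : Feasible n T ω τ := ⟨hord, fun _ ↦ hlast.trans_le htT⟩
    rw [ht, hopt, ← hτ.CC_eq]
    exact Nat.sInf_le ⟨τ, hτ, rfl⟩
  · obtain ⟨τ₀, hord₀, hlast₀, -⟩ := Opt_attained Pidle Pwork G hn hfit
    obtain ⟨σ, hσ, hCC⟩ := Nat.sInf_mem (s := {c | ∃ σ : ℕ → ℕ,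
      Feasible n T ω σ ∧ c = CC n T ω Pidle Pwork G σ})
      ⟨_, τ₀, ⟨hord₀, fun _ ↦ hlast₀.le⟩, rfl⟩
    rw [hCC, hσ.CC_eq]
    have hsum := sum_durations_le_completion hσ.1 (Nat.sub_lt hn one_pos)
    rw [Nat.sub_one_add_one hn.ne'] at hsum
    refine Nat.add_le_add_right ?_ _
    refine le_trans (Nat.sInf_le (m := Opt ω Pidle Pwork G n (σ (n - 1) + ω (n - 1))) ?_) ?_
    · exact ⟨_, hsum, hσ.2 hn, rfl⟩
    · exact Nat.sInf_le ⟨σ, hσ.1, rfl, rfl⟩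
end

section
/- If a schedule σ of the associated UCAS instance has carbon cost 0, then every task is executed entirely inside a single green segment: for every i ∈ {1,…,3n} there is 1 ≤ k ≤ n with (k−1)(B+1) ≤ σ(i) and σ(i) + x_i ≤ (k−1)(B+1) + B. Moreover, letting S_k be the set of tasks executed inside the k-th green segment, the sets S_1, …, S_n partition {1,…,3n} and satisfy Σ_{i ∈ S_k} x_i = B for every k. -/
/-!
In a zero-cost schedule of the associated UCAS instance, every task is executed
entirely inside one green segment `[k(B+1), k(B+1)+B)` (segments `0`-indexed),
and the resulting sets `S_k` of tasks executed in the `k`-th segment partition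
the tasks, each summing to `B`.
-/

/-- Horizon of the UCAS instance associated with a 3-Partition instance. -/
def ucasT (n B : ℕ) : ℕ := n * B + n - 1

/-- Green power budget at time unit `t`: `1` on green units, `0` on separators. -/
def green (B t : ℕ) : ℕ := if t % (B + 1) < B then 1 else 0

/-- σ is a valid schedule: every task completes by the horizon. -/
def IsSchedule (n B : ℕ) (x σ : Fin (3 * n) → ℕ) : Prop :=
  ∀ i, σ i + x i ≤ ucasT n B

/-- Number of tasks active at time unit `t`. -/
def ActiveCount (n : ℕ) (x σ : Fin (3 * n) → ℕ) (t : ℕ) : ℕ :=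
  (Finset.univ.filter fun i : Fin (3 * n) => σ i ≤ t ∧ t < σ i + x i).card

/-- Total carbon cost of σ: `∑_{t<T} max(A(t) - g(t), 0)`. -/
def carbonCost (n B : ℕ) (x σ : Fin (3 * n) → ℕ) : ℕ :=
  ∑ t ∈ Finset.range (ucasT n B), (ActiveCount n x σ t - green B t)

/-- `x` admits a 3-partition: a partition of the `3n` indices into `n` subsets,
each summing to `B`. -/
def ThreePartition (n B : ℕ) (x : Fin (3 * n) → ℕ) : Prop :=
  ∃ S : Fin n → Finset (Fin (3 * n)),
    (∀ i, ∃! k, i ∈ S k) ∧ ∀ k, ∑ i ∈ S k, x i = B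

theorem activeCount_le_green {n B : ℕ} {x σ : Fin (3 * n) → ℕ}
    (hcost : carbonCost n B x σ = 0) {t : ℕ} (ht : t < ucasT n B) :
    ActiveCount n x σ t ≤ green B t :=
  Nat.sub_eq_zero_iff_le.mp (Finset.sum_eq_zero_iff.mp hcost t (Finset.mem_range.mpr ht))

/-- At zero cost no task is active at a separator, so it stays in the segment it starts in. -/
theorem exists_segment_of_carbonCost_eq_zero {n B : ℕ} {x σ : Fin (3 * n) → ℕ}
    (hσ : IsSchedule n B x σ) (hcost : carbonCost n B x σ = 0)
    (i : Fin (3 * n)) (hxi : 0 < x i) :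
    ∃ k : Fin n, (k : ℕ) * (B + 1) ≤ σ i ∧ σ i + x i ≤ (k : ℕ) * (B + 1) + B := by
  have hT : σ i + x i ≤ n * B + n - 1 := hσ i
  have hq : σ i / (B + 1) < n := by
    rw [Nat.div_lt_iff_lt_mul (by omega : 0 < B + 1), mul_add, mul_one]
    omega
  refine ⟨⟨σ i / (B + 1), hq⟩, Nat.div_mul_le_self _ _, ?_⟩
  by_contra! hlt
  set t := σ i / (B + 1) * (B + 1) + B with ht
  have hle : σ i ≤ t := by
    have := Nat.div_add_mod' (σ i) (B + 1)
    have := Nat.mod_lt (σ i) (by omega : 0 < B + 1)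
    omega
  have hgreen : green B t = 0 := by
    have hmod : t % (B + 1) = B := by
      rw [ht, Nat.mul_add_mod_self_right, Nat.mod_eq_of_lt (Nat.lt_succ_self B)]
    simp [green, hmod]
  have hact := activeCount_le_green hcost (t := t) (lt_of_lt_of_le hlt (hσ i))
  have hpos : 0 < ActiveCount n x σ t :=
    Finset.card_pos.mpr ⟨i, by simpa using ⟨hle, hlt⟩⟩
  omega

/-- At zero cost, tasks never overlap in time. -/
theorem pairwise_disjoint_of_carbonCost_eq_zero {n B : ℕ} {x σ : Fin (3 * n) → ℕ}
    (hσ : IsSchedule n B x σ) (hcost : carbonCost n B x σ = 0) :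
    Pairwise fun i j => Disjoint (Finset.Ico (σ i) (σ i + x i)) (Finset.Ico (σ j) (σ j + x j)) := by
  intro i j hij
  refine Finset.disjoint_left.mpr fun t hi hj => hij ?_
  rw [Finset.mem_Ico] at hi hj
  have hact := activeCount_le_green hcost (lt_of_lt_of_le hi.2 (hσ i))
  have hone : green B t ≤ 1 := by
    unfold green
    split <;> omega
  exact Finset.card_le_one.mp (hact.trans hone) i (by simpa using hi) j (by simpa using hj)

/-- Tasks executed within a common window of length `B` have total duration at most `B`. -/
theorem sum_duration_le_of_carbonCost_eq_zero {n B : ℕ} {x σ : Fin (3 * n) → ℕ}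
    (hσ : IsSchedule n B x σ) (hcost : carbonCost n B x σ = 0) (a : ℕ) :
    ∑ i ∈ Finset.univ.filter (fun j : Fin (3 * n) => a ≤ σ j ∧ σ j + x j ≤ a + B), x i ≤ B := by
  set S := Finset.univ.filter (fun j : Fin (3 * n) => a ≤ σ j ∧ σ j + x j ≤ a + B) with hS
  calc ∑ i ∈ S, x i = (S.biUnion fun i => Finset.Ico (σ i) (σ i + x i)).card := by
        rw [Finset.card_biUnion fun i _ j _ hij =>
          pairwise_disjoint_of_carbonCost_eq_zero hσ hcost hij]
        simp
    _ ≤ (Finset.Ico a (a + B)).card := by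
        refine Finset.card_le_card (Finset.biUnion_subset.mpr fun i hi => ?_)
        rw [hS, Finset.mem_filter] at hi
        exact Finset.Ico_subset_Ico hi.2.1 hi.2.2
    _ = B := by simp

/-- Every task of a zero-cost schedule fits inside a single green segment, and the
sets of tasks per segment form a partition with part sums `B`. -/
theorem zero_cost_schedule_segments
    (n B : ℕ) (hn : 0 < n) (hB : 0 < B) (x : Fin (3 * n) → ℕ)
    (hsum : ∑ i, x i = n * B)
    (hx : ∀ i, B < 4 * x i ∧ 2 * x i < B)
    (σ : Fin (3 * n) → ℕ) (hσ : IsSchedule n B x σ)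
    (hcost : carbonCost n B x σ = 0) :
    (∀ i, ∃ k : Fin n,
        (k : ℕ) * (B + 1) ≤ σ i ∧ σ i + x i ≤ (k : ℕ) * (B + 1) + B) ∧
    (∀ i, ∃! k : Fin n,
        i ∈ Finset.univ.filter (fun j : Fin (3 * n) =>
          (k : ℕ) * (B + 1) ≤ σ j ∧ σ j + x j ≤ (k : ℕ) * (B + 1) + B)) ∧
    (∀ k : Fin n,
        ∑ i ∈ Finset.univ.filter (fun j : Fin (3 * n) =>
          (k : ℕ) * (B + 1) ≤ σ j ∧ σ j + x j ≤ (k : ℕ) * (B + 1) + B), x i = B) := by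
  have hpos : ∀ i, 0 < x i := fun i => by have := (hx i).1; omega
  have hseg := fun i => exists_segment_of_carbonCost_eq_zero hσ hcost i (hpos i)
  have huniq : ∀ i, ∀ k l : Fin n,
      (k : ℕ) * (B + 1) ≤ σ i ∧ σ i + x i ≤ (k : ℕ) * (B + 1) + B →
      (l : ℕ) * (B + 1) ≤ σ i ∧ σ i + x i ≤ (l : ℕ) * (B + 1) + B → k = l := by
    have hdiv : ∀ i, ∀ k : Fin n, (k : ℕ) * (B + 1) ≤ σ i ∧ σ i + x i ≤ (k : ℕ) * (B + 1) + B →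
        σ i / (B + 1) = k := fun i k hk => by
      have := hpos i
      refine Nat.div_eq_of_lt_le hk.1 ?_
      rw [Nat.succ_mul]
      omega
    exact fun i k l hk hl => Fin.ext ((hdiv i k hk).symm.trans (hdiv i l hl))
  refine ⟨hseg, fun i => ?_, ?_⟩
  · obtain ⟨k, hk⟩ := hseg i
    exact ⟨k, by simpa using hk, fun l hl => huniq i l k (by simpa using hl) hk⟩
  · set S : Fin n → Finset (Fin (3 * n)) := fun k => Finset.univ.filter fun j =>
      (k : ℕ) * (B + 1) ≤ σ j ∧ σ j + x j ≤ (k : ℕ) * (B + 1) + B with hS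
    have hle : ∀ k ∈ Finset.univ, ∑ i ∈ S k, x i ≤ B := fun k _ =>
      sum_duration_le_of_carbonCost_eq_zero hσ hcost _
    have hcover : Finset.univ.biUnion S = Finset.univ := by
      ext i
      simpa [hS] using hseg i
    have hdisj : Set.PairwiseDisjoint (Finset.univ : Finset (Fin n)) S := fun k _ l _ hkl =>
      Finset.disjoint_left.mpr fun i hk hl =>
        hkl (huniq i k l (Finset.mem_filter.mp hk).2 (Finset.mem_filter.mp hl).2)
    have htotal : ∑ k, ∑ i ∈ S k, x i = ∑ _k : Fin n, B := by
      rw [← Finset.sum_biUnion hdisj, hcover, hsum]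
      simp
    exact fun k => (Finset.sum_eq_sum_iff_of_le hle).mp htotal k (Finset.mem_univ k)
end
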